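/- Every finite simple graph on n vertices has at most 3^{n/3} maximal independent sets, where 3^{n/3} denotes the real number 3 raised to the power n/3. -/

import Mathlib

open SimpleGraph

/-- `I` is a maximal independent set of `G`: pairwise nonadjacent and not properly
contained in any other independent set of `G`. -/
def IsMaxIndepSet {V : Type*} (G : SimpleGraph V) (I : Set V) : Prop :=
  I.Pairwise (fun a b => ¬ G.Adj a b) ∧
    ∀ J : Set V, J.Pairwise (fun a b => ¬ G.Adj a b) → I ⊆ J → I = J

namespace SimpleGraph

variable {V : Type*} (G : SimpleGraph V)

/-- `I` is a maximal independent subset of `S`, in the form of an independent dominating set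
of the subgraph induced on `S`. -/
def IsIndepDominating (S I : Finset V) : Prop :=
  I ⊆ S ∧ (∀ a ∈ I, ∀ b ∈ I, ¬ G.Adj a b) ∧ ∀ v ∈ S, v ∉ I → ∃ u ∈ I, G.Adj v u

open Classical in
/-- The finset of all independent dominating sets of the subgraph induced on `S`. -/
noncomputable def indepDominatingSets (S : Finset V) : Finset (Finset V) :=
  {I ∈ S.powerset | G.IsIndepDominating S I}

open Classical in
/-- The closed neighborhood of `w` within `S`. -/
noncomputable def closedNeighborsIn (S : Finset V) (w : V) : Finset V :=
  {u ∈ S | u = w ∨ G.Adj w u}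

variable {G}

theorem mem_indepDominatingSets {S I : Finset V} :
    I ∈ G.indepDominatingSets S ↔ G.IsIndepDominating S I := by
  simp only [indepDominatingSets, Finset.mem_filter, Finset.mem_powerset, and_iff_right_iff_imp]
  exact fun h => h.1

theorem mem_closedNeighborsIn {S : Finset V} {u w : V} :
    u ∈ G.closedNeighborsIn S w ↔ u ∈ S ∧ (u = w ∨ G.Adj w u) := by
  simp [closedNeighborsIn]

theorem IsIndepDominating.exists_mem_closedNeighborsIn {S I : Finset V}
    (h : G.IsIndepDominating S I) {v : V} (hv : v ∈ S) :
    ∃ w ∈ G.closedNeighborsIn S v, w ∈ I := by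
  by_cases hvI : v ∈ I
  · exact ⟨v, mem_closedNeighborsIn.2 ⟨hv, .inl rfl⟩, hvI⟩
  · obtain ⟨u, hu, huv⟩ := h.2.2 v hv hvI
    exact ⟨u, mem_closedNeighborsIn.2 ⟨h.1 hu, .inr huv⟩, hu⟩

open Classical in
theorem IsIndepDominating.erase {S I : Finset V} (h : G.IsIndepDominating S I) {w : V}
    (hw : w ∈ I) : G.IsIndepDominating (S \ G.closedNeighborsIn S w) (I.erase w) := by
  obtain ⟨hsub, hind, hdom⟩ := h
  refine ⟨fun a ha => ?_, fun a ha b hb => ?_, fun v hv hvI => ?_⟩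
  · rw [Finset.mem_erase] at ha
    rw [Finset.mem_sdiff, mem_closedNeighborsIn]
    exact ⟨hsub ha.2, fun h => h.2.elim ha.1 (hind w hw a ha.2)⟩
  · exact hind a (Finset.mem_of_mem_erase ha) b (Finset.mem_of_mem_erase hb)
  · rw [Finset.mem_sdiff, mem_closedNeighborsIn] at hv
    have hvw : v ≠ w := fun h => hv.2 ⟨hv.1, .inl h⟩
    obtain ⟨u, hu, huv⟩ := hdom v hv.1 fun h => hvI (Finset.mem_erase.2 ⟨hvw, h⟩)
    refine ⟨u, Finset.mem_erase.2 ⟨?_, hu⟩, huv⟩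
    rintro rfl
    exact hv.2 ⟨hv.1, .inr huv.symm⟩

open Classical in
theorem card_filter_mem_indepDominatingSets_le (S : Finset V) (w : V) :
    {I ∈ G.indepDominatingSets S | w ∈ I}.card ≤
      (G.indepDominatingSets (S \ G.closedNeighborsIn S w)).card := by
  refine Finset.card_le_card_of_injOn (fun I => I.erase w) (fun I hI => ?_) fun I hI J hJ hIJ => ?_
  · have hI := Finset.mem_filter.1 hI
    exact mem_indepDominatingSets.2 ((mem_indepDominatingSets.1 hI.1).erase hI.2)
  · rw [← Finset.insert_erase (Finset.mem_filter.1 hI).2,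
      ← Finset.insert_erase (Finset.mem_filter.1 hJ).2]
    exact congrArg (insert w) hIJ

open Classical in
theorem card_indepDominatingSets_le_sum (S : Finset V) {v : V} (hv : v ∈ S) :
    (G.indepDominatingSets S).card ≤
      ∑ w ∈ G.closedNeighborsIn S v,
        (G.indepDominatingSets (S \ G.closedNeighborsIn S w)).card := by
  calc (G.indepDominatingSets S).card
      ≤ ((G.closedNeighborsIn S v).biUnion
          fun w => {I ∈ G.indepDominatingSets S | w ∈ I}).card := by
        refine Finset.card_le_card fun I hI => ?_
        obtain ⟨w, hw, hwI⟩ :=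
          (mem_indepDominatingSets.1 hI).exists_mem_closedNeighborsIn hv
        exact Finset.mem_biUnion.2 ⟨w, hw, Finset.mem_filter.2 ⟨hI, hwI⟩⟩
    _ ≤ _ := Finset.card_biUnion_le.trans
        (Finset.sum_le_sum fun w _ => card_filter_mem_indepDominatingSets_le S w)

end SimpleGraph

theorem Nat.pow_three_le_three_pow (k : ℕ) : k ^ 3 ≤ 3 ^ k := by
  rcases lt_or_ge k 3 with hk | hk
  · interval_cases k <;> norm_num
  · induction k, hk using Nat.le_induction with
    | base => norm_num
    | succ k hk ih =>
      rw [pow_succ 3 k]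
      nlinarith [Nat.mul_le_mul_left k hk, Nat.mul_le_mul_left (k ^ 2) hk]

theorem Real.natCast_le_three_rpow_div_three (k : ℕ) : (k : ℝ) ≤ 3 ^ ((k : ℝ) / 3) := by
  refine le_of_pow_le_pow_left₀ (n := 3) (by norm_num) (by positivity) ?_
  rw [← Real.rpow_mul_natCast (by norm_num), Nat.cast_ofNat,
    div_mul_cancel₀ _ (by norm_num), Real.rpow_natCast]
  exact_mod_cast Nat.pow_three_le_three_pow k

namespace SimpleGraph

variable {V : Type*} {G : SimpleGraph V}

theorem card_indepDominatingSets_le (S : Finset V) :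
    ((G.indepDominatingSets S).card : ℝ) ≤ 3 ^ ((S.card : ℝ) / 3) := by
  classical
  induction S using Finset.strongInduction with
  | H S ih =>
    rcases S.eq_empty_or_nonempty with rfl | hS
    · have : (G.indepDominatingSets ∅).card ≤ 1 :=
        (Finset.card_filter_le _ _).trans (by simp)
      simpa using this
    obtain ⟨v, hv, hmin⟩ := S.exists_min_image (fun w => (G.closedNeighborsIn S w).card) hS
    set k := (G.closedNeighborsIn S v).card with hk
    have hsub (w : V) : G.closedNeighborsIn S w ⊆ S := Finset.filter_subset _ _
    have hterm : ∀ w ∈ G.closedNeighborsIn S v,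
        ((G.indepDominatingSets (S \ G.closedNeighborsIn S w)).card : ℝ) ≤
          3 ^ (((S.card : ℝ) - k) / 3) := fun w hw => by
      have hwS := hsub v hw
      have hww : w ∈ G.closedNeighborsIn S w := mem_closedNeighborsIn.2 ⟨hwS, .inl rfl⟩
      refine (ih _ (Finset.sdiff_ssubset (hsub w) ⟨w, hww⟩)).trans ?_
      refine Real.rpow_le_rpow_of_exponent_le (by norm_num) ?_
      rw [Finset.cast_card_sdiff (hsub w)]
      have : (k : ℝ) ≤ (G.closedNeighborsIn S w).card := by exact_mod_cast hmin w hwS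
      gcongr
    calc ((G.indepDominatingSets S).card : ℝ)
        ≤ ∑ w ∈ G.closedNeighborsIn S v,
            ((G.indepDominatingSets (S \ G.closedNeighborsIn S w)).card : ℝ) := by
          exact_mod_cast card_indepDominatingSets_le_sum S hv
      _ ≤ k * 3 ^ (((S.card : ℝ) - k) / 3) := by
          simpa [nsmul_eq_mul] using Finset.sum_le_card_nsmul _ _ _ hterm
      _ ≤ 3 ^ ((k : ℝ) / 3) * 3 ^ (((S.card : ℝ) - k) / 3) := by
          gcongr
          exact Real.natCast_le_three_rpow_div_three k
      _ = 3 ^ ((S.card : ℝ) / 3) := by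
          rw [← Real.rpow_add (by norm_num)]
          ring_nf

end SimpleGraph

theorem IsMaxIndepSet.exists_adj {V : Type*} {G : SimpleGraph V} {I : Set V}
    (h : IsMaxIndepSet G I) {v : V} (hv : v ∉ I) : ∃ u ∈ I, G.Adj v u := by
  by_contra! hno
  have hins : (insert v I).Pairwise (fun a b => ¬ G.Adj a b) :=
    h.1.insert fun b hb _ => ⟨hno b hb, fun hadj => hno b hb hadj.symm⟩
  exact hv (h.2 _ hins (Set.subset_insert v I) ▸ Set.mem_insert v I)

open Classical in
theorem IsMaxIndepSet.isIndepDominating {V : Type*} [Fintype V] {G : SimpleGraph V} {I : Set V}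
    (h : IsMaxIndepSet G I) : G.IsIndepDominating Finset.univ I.toFinset := by
  refine ⟨Finset.subset_univ _, fun a ha b hb hab => ?_, fun v _ hv => ?_⟩
  · exact h.1 (Set.mem_toFinset.1 ha) (Set.mem_toFinset.1 hb) hab.ne hab
  · simpa using h.exists_adj (mt Set.mem_toFinset.2 hv)

/-- (Moon–Moser bound) Every finite simple graph on `n` vertices has at
most `3^(n/3)` maximal independent sets. -/
theorem card_maxIndepSets_le {V : Type*} [Fintype V] (G : SimpleGraph V) :
    ({I : Set V | IsMaxIndepSet G I}.ncard : ℝ) ≤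
      (3 : ℝ) ^ ((Fintype.card V : ℝ) / 3) := by
  classical
  refine le_trans ?_ (SimpleGraph.card_indepDominatingSets_le (G := G) Finset.univ)
  rw [← Set.ncard_coe_finset]
  exact_mod_cast Set.ncard_le_ncard_of_injOn (fun I : Set V => I.toFinset)
    (fun I hI => SimpleGraph.mem_indepDominatingSets.2 (IsMaxIndepSet.isIndepDominating hI))
    (fun I _ J _ hIJ => Set.toFinset_inj.1 hIJ)
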